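/- Let d ≥ 1 and n ≥ d be integers. Let Y_1, …, Y_n be i.i.d. standard Gaussian random vectors in ℝ^d and let Ŝ_n := (1/n) ∑_{i=1}^n Y_i Y_iᵀ. Then the expected reverse KL risk of the Gaussian covariance MLE equals E[ (1/2)(tr(Ŝ_n) − d − log det Ŝ_n) ] = (1/2)·( d·log(n/2) − ∑_{j=1}^d ψ((n−j+1)/2) ). -/

import Mathlib

open MeasureTheory ProbabilityTheory Matrix

/-- The digamma function `ψ(x) = (log Γ)'(x)`. -/
noncomputable def digamma (x : ℝ) : ℝ := deriv (fun t => Real.log (Real.Gamma t)) x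

/-- The law of `n` i.i.d. standard Gaussian vectors in `ℝ^d`. -/
noncomputable def stdGaussianSample (n d : ℕ) : Measure (Fin n → Fin d → ℝ) :=
  Measure.pi fun _ => Measure.pi fun _ => gaussianReal 0 1

/-- Empirical second-moment matrix `Ŝ_n = (1/n) ∑ Y_i Y_iᵀ`. -/
noncomputable def empSecondMoment (n d : ℕ) (Y : Fin n → Fin d → ℝ) :
    Matrix (Fin d) (Fin d) ℝ :=
  ((n : ℝ)⁻¹) • ∑ i : Fin n, vecMulVec (Y i) (Y i)

lemma chi_mellin (s : ℝ) (hs : 0 < s) :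
    IntegrableOn (fun y : ℝ => y ^ (s - 1) * (Real.log y * Real.exp (-(1/2) * y ^ (2:ℝ)))) (Set.Ioi 0) ∧
    HasDerivAt (fun s : ℝ => ∫ y in Set.Ioi (0:ℝ), y ^ (s - 1) * Real.exp (-(1/2) * y ^ (2:ℝ)))
      (∫ y in Set.Ioi (0:ℝ), y ^ (s - 1) * (Real.log y * Real.exp (-(1/2) * y ^ (2:ℝ)))) s := by
  have key := mellin_hasDerivAt_of_isBigO_rpow (E := ℂ) (a := s + 1) (b := 0) (s := (s : ℂ))
    (f := fun y : ℝ => ((Real.exp (-(1/2) * y ^ (2:ℝ)) : ℝ) : ℂ)) ?_ ?_ ?_ ?_ ?_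
  · obtain ⟨h1, h2⟩ := key
    have e1 : ∀ s : ℝ, ∀ g : ℝ → ℝ, ∀ y ∈ Set.Ioi (0:ℝ),
        ((y : ℂ) ^ ((s : ℂ) - 1) • ((g y : ℝ) : ℂ)) = ((y ^ (s - 1) * g y : ℝ) : ℂ) := by
      intro s g y hy
      rw [smul_eq_mul, Complex.ofReal_mul, Complex.ofReal_cpow (le_of_lt hy)]
      simp
    have e2 : (fun t : ℝ => Real.log t • ((Real.exp (-(1/2) * t ^ (2:ℝ)) : ℝ) : ℂ)) =
       fun t : ℝ => ((Real.log t * Real.exp (-(1/2) * t ^ (2:ℝ)) : ℝ) : ℂ) := by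
      ext t; simp
    have e3 : ∀ s : ℝ, ∀ g : ℝ → ℝ, mellin (fun t => ((g t : ℝ) : ℂ)) (s : ℂ) =
       ((∫ y in Set.Ioi (0:ℝ), y ^ (s - 1) * g y : ℝ) : ℂ) := by
      intro s g
      rw [mellin, setIntegral_congr_fun measurableSet_Ioi (e1 s g)]
      exact integral_ofReal
    rw [e2] at h1 h2
    constructor
    · have h3 := (integrableOn_congr_fun
        (e1 s (fun t => Real.log t * Real.exp (-(1/2) * t ^ (2:ℝ)))) measurableSet_Ioi).1 h1
      exact h3.re
    · have h4 := h2.real_of_complex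
      rw [e3 s] at h4
      simp only [e3 _ (fun t => Real.exp (-(1/2) * t ^ (2:ℝ))), Complex.ofReal_re] at h4
      exact h4
  · refine (Continuous.continuousOn ?_).locallyIntegrableOn measurableSet_Ioi
    refine Complex.continuous_ofReal.comp (Real.continuous_exp.comp ?_)
    exact continuous_const.mul (Real.continuous_rpow_const (by norm_num))
  · rw [← Asymptotics.isBigO_norm_left]
    simp_rw [Complex.norm_real, Asymptotics.isBigO_norm_left]
    have h := (isLittleO_exp_neg_mul_rpow_atTop (show (0:ℝ) < 1/2 by norm_num) (-(s+1))).isBigO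
    refine Asymptotics.IsBigO.trans (Asymptotics.IsBigO.of_bound 1 ?_) h
    filter_upwards [Filter.eventually_ge_atTop (1:ℝ)] with y hy
    rw [Real.norm_of_nonneg (Real.exp_pos _).le, Real.norm_of_nonneg (Real.exp_pos _).le, one_mul]
    apply Real.exp_le_exp.2
    rw [Real.rpow_two]; nlinarith
  · simp
  · simp_rw [neg_zero, Real.rpow_zero]
    refine Asymptotics.IsBigO.of_bound 1 ?_
    refine Filter.Eventually.of_forall fun y => ?_
    rw [Complex.norm_real, Real.norm_of_nonneg (Real.exp_pos _).le, norm_one, mul_one,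
      Real.exp_le_one_iff, Real.rpow_two]
    nlinarith [sq_nonneg y]
  · simpa using hs

lemma chi_val (s : ℝ) (hs : 0 < s) :
    ∫ y in Set.Ioi (0:ℝ), y ^ (s - 1) * Real.exp (-(1/2) * y ^ (2:ℝ))
      = (1/2 : ℝ) ^ (-s/2) * (1/2) * Real.Gamma (s/2) := by
  rw [integral_rpow_mul_exp_neg_mul_rpow (by norm_num) (by linarith) (by norm_num)]
  simp

lemma chi_log (s : ℝ) (hs : 0 < s) :
    2 * (∫ y in Set.Ioi (0:ℝ), y ^ (s - 1) * (Real.log y * Real.exp (-(1/2) * y ^ (2:ℝ))))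
     = (Real.log 2 + digamma (s/2)) *
       ∫ y in Set.Ioi (0:ℝ), y ^ (s - 1) * Real.exp (-(1/2) * y ^ (2:ℝ)) := by
  have h := (chi_mellin s hs).2
  have hG : ∀ t : ℝ, 0 < t → DifferentiableAt ℝ Real.Gamma t := fun t ht =>
    Real.differentiableAt_Gamma (fun m => by have : (0:ℝ) ≤ m := m.cast_nonneg; linarith)
  have hne : Real.Gamma (s/2) ≠ 0 := (Real.Gamma_pos_of_pos (by linarith)).ne'
  have hd : digamma (s/2) = deriv Real.Gamma (s/2) / Real.Gamma (s/2) :=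
    deriv.log (hG _ (by linarith)) hne
  have h1 : HasDerivAt (fun t : ℝ => (1/2 : ℝ) ^ (-t/2) * (1/2) * Real.Gamma (t/2))
     ((Real.log (1/2) * (-1/2) * (1/2 : ℝ) ^ (-s/2)) * (1/2) * Real.Gamma (s/2) +
      (1/2 : ℝ) ^ (-s/2) * (1/2) * (deriv Real.Gamma (s/2) * (1/2))) s := by
    have a1 : HasDerivAt (fun t : ℝ => -t/2) (-1/2) s := ((hasDerivAt_id s).neg).div_const 2
    have a2 : HasDerivAt (fun t : ℝ => t/2) (1/2) s := (hasDerivAt_id s).div_const 2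
    have a3 := (hG (s/2) (by linarith)).hasDerivAt.comp s a2
    exact ((a1.const_rpow (by norm_num : (0:ℝ) < 1/2)).mul_const (1/2)).mul a3
  have h2 := h.unique (h1.congr_of_eventuallyEq (by
    filter_upwards [lt_mem_nhds hs] with t ht using chi_val t ht))
  rw [h2, chi_val s hs, hd]
  have : Real.log (1/2) = - Real.log 2 := by simp
  rw [this]
  field_simp
section gauss
variable {V : Type*} [NormedAddCommGroup V] [InnerProductSpace ℝ V] [FiniteDimensional ℝ V]
  [MeasurableSpace V] [BorelSpace V]

open Complex in
lemma stdGaussian_density : stdGaussian V = (volume : Measure V).withDensity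
    (fun x => ENNReal.ofReal (((2 * Real.pi) ^ (Module.finrank ℝ V / 2 : ℝ))⁻¹ *
      Real.exp (-(1/2) * ‖x‖ ^ 2))) := by
  set C : ℝ := (2 * Real.pi) ^ (Module.finrank ℝ V / 2 : ℝ) with hC
  have hCpos : 0 < C := by positivity
  have hint : Integrable (fun x : V => C⁻¹ * Real.exp (-(1/2) * ‖x‖ ^ 2)) := by
    have h := (GaussianFourier.integrable_cexp_neg_mul_sq_norm_add (V := V) (b := 1/2)
      (by norm_num) 0 0).re
    refine Integrable.const_mul ?_ _
    convert h using 2 with x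
    have : (-(1/2 : ℂ) * (‖x‖ : ℂ)^2 + 0 * ((inner ℝ (0:V) x : ℝ) : ℂ))
      = ((-(1/2) * ‖x‖^2 : ℝ) : ℂ) := by push_cast; ring
    rw [this, ← Complex.ofReal_exp]
    rfl
  have : IsFiniteMeasure ((volume : Measure V).withDensity
    (fun x => ENNReal.ofReal (C⁻¹ * Real.exp (-(1/2) * ‖x‖ ^ 2)))) :=
    isFiniteMeasure_withDensity_ofReal hint.2
  apply Measure.ext_of_charFun
  ext t
  rw [charFun_stdGaussian, charFun_apply, integral_withDensity_eq_integral_toReal_smul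
    (by fun_prop) (by simp)]
  have h := GaussianFourier.integral_cexp_neg_mul_sq_norm_add (V := V) (b := 1/2)
      (by norm_num) Complex.I t
  have e : ∀ x : V, (ENNReal.ofReal (C⁻¹ * Real.exp (-(1/2) * ‖x‖ ^ 2))).toReal •
      cexp ((inner ℝ x t : ℝ) * I) = (C : ℂ)⁻¹ * cexp (-(1/2) * ‖x‖ ^ 2 + I * (inner ℝ t x : ℝ)) := by
    intro x
    rw [ENNReal.toReal_ofReal (by positivity), Complex.real_smul, real_inner_comm, Complex.exp_add]
    push_cast
    ring_nf
  simp_rw [e]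
  rw [integral_const_mul, h]
  have h2 : ((Real.pi : ℂ) / (1/2)) ^ (Module.finrank ℝ V / 2 : ℂ) = (C : ℂ) := by
    rw [hC, Complex.ofReal_cpow (by positivity)]
    push_cast
    congr 1
    ring
  rw [h2, ← mul_assoc, inv_mul_cancel₀ (by exact_mod_cast hCpos.ne'), one_mul]
  congr 1
  rw [Complex.I_sq]
  ring

lemma integrable_stdGaussian_iff (f : V → ℝ) : Integrable f (stdGaussian V) ↔
    Integrable (fun x => Real.exp (-(1/2) * ‖x‖ ^ 2) * f x) := by
  rw [stdGaussian_density, integrable_withDensity_iff_integrable_smul' (by fun_prop) (by simp)]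
  have hCpos : 0 < ((2 * Real.pi) ^ (Module.finrank ℝ V / 2 : ℝ)) := by positivity
  rw [← integrable_const_mul_iff (c := ((2 * Real.pi) ^ (Module.finrank ℝ V / 2 : ℝ))⁻¹)
    (IsUnit.mk0 _ (by positivity)) (fun x : V => Real.exp (-(1/2) * ‖x‖ ^ 2) * f x)]
  refine integrable_congr (Filter.Eventually.of_forall fun x => ?_)
  simp only
  rw [ENNReal.toReal_ofReal (by positivity), smul_eq_mul, mul_assoc]

lemma integral_stdGaussian_eq (f : V → ℝ) : ∫ x, f x ∂(stdGaussian V) =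
    ((2 * Real.pi) ^ (Module.finrank ℝ V / 2 : ℝ))⁻¹ *
     ∫ x, Real.exp (-(1/2) * ‖x‖ ^ 2) * f x := by
  rw [stdGaussian_density, integral_withDensity_eq_integral_toReal_smul (by fun_prop) (by simp),
    ← integral_const_mul]
  refine integral_congr_ae (Filter.Eventually.of_forall fun x => ?_)
  simp only
  rw [ENNReal.toReal_ofReal (by positivity), smul_eq_mul, mul_assoc]

lemma stdGaussian_log_norm (hV : 0 < Module.finrank ℝ V) :
    (∀ᵐ x ∂(stdGaussian V), x ≠ 0) ∧
    Integrable (fun x : V => Real.log (‖x‖ ^ 2)) (stdGaussian V) ∧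
    ∫ x, Real.log (‖x‖ ^ 2) ∂(stdGaussian V)
      = Real.log 2 + digamma ((Module.finrank ℝ V : ℝ) / 2) := by
  have : Nontrivial V := Module.finrank_pos_iff.1 hV
  have hm : (0:ℝ) < Module.finrank ℝ V := by exact_mod_cast hV
  have e0 : ∀ y ∈ Set.Ioi (0:ℝ), y ^ (Module.finrank ℝ V - 1) = y ^ ((Module.finrank ℝ V : ℝ) - 1) := by
    intro y hy
    rw [← Real.rpow_natCast, Nat.cast_sub hV, Nat.cast_one]
  have e1 : ∀ y ∈ Set.Ioi (0:ℝ), y ^ (Module.finrank ℝ V - 1) •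
      (Real.exp (-(1/2) * y ^ 2) * Real.log (y ^ 2)) = 2 * (y ^ ((Module.finrank ℝ V : ℝ) - 1) *
        (Real.log y * Real.exp (-(1/2) * y ^ (2:ℝ)))) := by
    intro y hy
    rw [e0 y hy, Real.log_pow, Real.rpow_two, smul_eq_mul]; push_cast; ring
  have e2 : ∀ y ∈ Set.Ioi (0:ℝ), y ^ (Module.finrank ℝ V - 1) •
      (Real.exp (-(1/2) * y ^ 2) * 1) = (y ^ ((Module.finrank ℝ V : ℝ) - 1) *
        (Real.exp (-(1/2) * y ^ (2:ℝ)))) := by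
    intro y hy
    rw [e0 y hy, Real.rpow_two, smul_eq_mul, mul_one]
  refine ⟨?_, ?_, ?_⟩
  · have h : ∀ᵐ x ∂(volume : Measure V), x ≠ 0 := by simp [ae_iff, measure_singleton]
    rw [stdGaussian_density]
    exact (withDensity_absolutelyContinuous _ _).ae_le h
  · rw [integrable_stdGaussian_iff]
    refine (integrable_fun_norm_addHaar (volume : Measure V)
      (f := fun y => Real.exp (-(1/2) * y ^ 2) * Real.log (y ^ 2))).2 ?_
    rw [integrableOn_congr_fun e1 measurableSet_Ioi]
    exact (chi_mellin _ hm).1.const_mul 2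
  · have h1 : (1:ℝ) = ∫ x : V, (1:ℝ) ∂(stdGaussian V) := by simp
    rw [integral_stdGaussian_eq, integral_fun_norm_addHaar (volume : Measure V)
      (fun y => Real.exp (-(1/2) * y ^ 2) * 1), setIntegral_congr_fun measurableSet_Ioi e2] at h1
    rw [integral_stdGaussian_eq, integral_fun_norm_addHaar (volume : Measure V)
      (fun y => Real.exp (-(1/2) * y ^ 2) * Real.log (y ^ 2)),
      setIntegral_congr_fun measurableSet_Ioi e1, integral_const_mul, chi_log _ hm]
    simp only [nsmul_eq_mul, smul_eq_mul] at h1 ⊢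
    linear_combination (-(Real.log 2 + digamma ((Module.finrank ℝ V : ℝ) / 2))) * h1

lemma stdGaussian_map_proj (U : Submodule ℝ V) :
    (stdGaussian V).map (fun x => U.orthogonalProjectionOnto x) = stdGaussian U := by
  apply Measure.ext_of_charFun
  ext t
  rw [charFun_stdGaussian, charFun_apply, integral_map (by fun_prop) (by fun_prop)]
  simp_rw [Submodule.inner_orthogonalProjectionOnto_eq_of_mem_right]
  rw [← charFun_apply, charFun_stdGaussian]
  rfl
end gauss

section gramdet
variable {V : Type*} [NormedAddCommGroup V] [InnerProductSpace ℝ V] [FiniteDimensional ℝ V]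

lemma gram_det_snoc {k : ℕ} (v : Fin k → V) (x : V) (hv : (gram ℝ v).det ≠ 0) :
    (gram ℝ (Fin.snoc v x : Fin (k+1) → V)).det = (gram ℝ v).det *
      ‖(Submodule.span ℝ (Set.range v))ᗮ.orthogonalProjectionOnto x‖ ^ 2 := by
  set U := Submodule.span ℝ (Set.range v) with hU
  set w : V := ((Uᗮ.orthogonalProjectionOnto x : Uᗮ) : V) with hw
  have hwU : w ∈ Uᗮ := (Uᗮ.orthogonalProjectionOnto x).2
  obtain ⟨u, hu, hxu⟩ : ∃ u ∈ U, x = u + w := by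
    refine ⟨U.orthogonalProjectionOnto x, (U.orthogonalProjectionOnto x).2, ?_⟩
    exact (U.starProjection_add_starProjection_orthogonal x).symm
  obtain ⟨a, ha⟩ := (Submodule.mem_span_range_iff_exists_fun ℝ).1 hu
  have hvw : ∀ i, inner ℝ (v i) w = 0 := fun i =>
    Submodule.inner_right_of_mem_orthogonal (Submodule.subset_span (Set.mem_range_self i)) hwU
  have huw : inner ℝ u w = 0 := Submodule.inner_right_of_mem_orthogonal hu hwU
  have : Invertible (gram ℝ v) := invertibleOfIsUnitDet _ (isUnit_iff_ne_zero.2 hv)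
  set B : Matrix (Fin k) (Fin 1) ℝ := of fun i _ => inner ℝ (v i) x with hB
  set A : Matrix (Fin k) (Fin 1) ℝ := of fun i _ => a i with hA
  have hBA : B = gram ℝ v * A := by
    ext i j
    simp only [hB, hA, of_apply, Matrix.mul_apply, gram_apply]
    rw [hxu, inner_add_right, hvw, add_zero, ← ha, inner_sum]
    simp_rw [inner_smul_right, mul_comm]
  have hblock : (gram ℝ (Fin.snoc v x : Fin (k+1) → V)).submatrix
      (finSumFinEquiv (m := k) (n := 1)) (finSumFinEquiv (m := k) (n := 1)) = fromBlocks (gram ℝ v) B Bᵀ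
      (of fun _ _ => inner ℝ x x) := by
    have hr : ∀ j : Fin 1, (finSumFinEquiv (Sum.inr j : Fin k ⊕ Fin 1)) = Fin.last k := by
      intro j; ext; simp
    have hl : ∀ j : Fin k, (finSumFinEquiv (Sum.inl j : Fin k ⊕ Fin 1)) = Fin.castSucc j := by
      intro j; ext; simp
    ext (i | i) (j | j) <;>
      simp only [submatrix_apply, gram_apply, hr, hl, Fin.snoc_castSucc, Fin.snoc_last,
        fromBlocks_apply₁₁, fromBlocks_apply₁₂, fromBlocks_apply₂₁, fromBlocks_apply₂₂, hB,
        of_apply, transpose_apply]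
    exact real_inner_comm _ _
  rw [← det_submatrix_equiv_self (finSumFinEquiv (m := k) (n := 1)), hblock, det_fromBlocks₁₁]
  congr 1
  have hIB : ⅟(gram ℝ v) * B = A := by
    rw [hBA, ← Matrix.mul_assoc, invOf_mul_self, Matrix.one_mul]
  rw [det_fin_one, Matrix.mul_assoc, hIB]
  have hBA' : (Bᵀ * A) 0 0 = inner ℝ x u := by
    simp only [Matrix.mul_apply, hB, hA, of_apply, transpose_apply]
    rw [← ha, inner_sum]
    refine Finset.sum_congr rfl fun i _ => ?_
    rw [inner_smul_right, real_inner_comm, mul_comm]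
  rw [Matrix.sub_apply, hBA', of_apply, ← inner_sub_right]
  have : x - u = w := by rw [hxu]; abel
  rw [this]
  nth_rewrite 1 [hxu]
  rw [inner_add_left, huw, zero_add, real_inner_self_eq_norm_sq, hw]
  rfl

variable [MeasurableSpace V] [BorelSpace V]

lemma measurable_gram_det (k : ℕ) : Measurable (fun v : Fin k → V => (gram ℝ v).det) := by
  have : Continuous (fun v : Fin k → V => (gram ℝ v).det) := by
    refine Continuous.matrix_det ?_
    refine continuous_matrix fun i j => ?_
    simp only [gram_apply]
    fun_prop
  exact this.measurable

lemma gram_log_det (k : ℕ) (hk : k ≤ Module.finrank ℝ V) :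
    (∀ᵐ v ∂(Measure.pi fun _ : Fin k => stdGaussian V), (gram ℝ v).det ≠ 0) ∧
    Integrable (fun v : Fin k → V => Real.log (gram ℝ v).det)
      (Measure.pi fun _ : Fin k => stdGaussian V) ∧
    ∫ v, Real.log (gram ℝ v).det ∂(Measure.pi fun _ : Fin k => stdGaussian V) =
      ∑ j ∈ Finset.range k, (Real.log 2 + digamma (((Module.finrank ℝ V : ℝ) - j) / 2)) := by
  induction k with
  | zero => simp
  | succ k ih =>
    obtain ⟨ih1, ih2, ih3⟩ := ih (by omega)
    set ν := Measure.pi fun _ : Fin k => stdGaussian V with hν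
    set γ := stdGaussian V with hγ
    have hmp := (measurePreserving_piFinSuccAbove (fun _ : Fin (k+1) => γ) (Fin.last k)).symm
    have hmp' : MeasurePreserving (fun p : V × (Fin k → V) => (Fin.snoc p.2 p.1 : Fin (k+1) → V))
        (γ.prod ν) (Measure.pi fun _ : Fin (k+1) => γ) := by
      convert hmp using 1
      ext p i
      simp [MeasurableEquiv.piFinSuccAbove, Fin.insertNthEquiv, Fin.insertNth_last']
    have hmp2 : MeasurePreserving (fun p : (Fin k → V) × V => (Fin.snoc p.1 p.2 : Fin (k+1) → V))
        (ν.prod γ) (Measure.pi fun _ : Fin (k+1) => γ) :=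
      hmp'.comp (Measure.measurePreserving_swap)
    clear hmp hmp'
    set m := Module.finrank ℝ V - k with hm
    have hm0 : 0 < m := by omega
    obtain ⟨w1, w2, w3⟩ := stdGaussian_log_norm (V := EuclideanSpace ℝ (Fin m)) (by simpa using hm0)
    rw [finrank_euclideanSpace_fin, hm, Nat.cast_sub (by omega), ← hm] at w3
    set c : ℝ := Real.log 2 + digamma (((Module.finrank ℝ V : ℝ) - k) / 2) with hc
    set G : (Fin k → V) × V → ℝ := fun p =>
      Real.log (gram ℝ (Fin.snoc p.1 p.2 : Fin (k+1) → V)).det - Real.log (gram ℝ p.1).det with hG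
    have hGm : Measurable G :=
      (Real.measurable_log.comp ((measurable_gram_det (k+1)).comp hmp2.measurable)).sub
        (Real.measurable_log.comp ((measurable_gram_det k).comp measurable_fst))
    -- conditional facts
    have hfib : ∀ v : Fin k → V, (gram ℝ v).det ≠ 0 → ∃ T : V → EuclideanSpace ℝ (Fin m),
        MeasurePreserving T γ (stdGaussian (EuclideanSpace ℝ (Fin m))) ∧
        ∀ᵐ x ∂γ, (gram ℝ (Fin.snoc v x : Fin (k+1) → V)).det ≠ 0 ∧
          G (v, x) = Real.log (‖T x‖ ^ 2) := by
      intro v hv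
      set U := Submodule.span ℝ (Set.range v) with hU
      have hUr : Module.finrank ℝ U = k := by
        rw [hU, finrank_span_eq_card (linearIndependent_of_det_gram_ne_zero hv), Fintype.card_fin]
      have hUo : Module.finrank ℝ Uᗮ = m := by
        have := U.finrank_add_finrank_orthogonal
        omega
      set e := ((stdOrthonormalBasis ℝ Uᗮ).reindex (finCongr hUo)).repr
      have hT : MeasurePreserving (fun x => e (Uᗮ.orthogonalProjectionOnto x)) γ
          (stdGaussian (EuclideanSpace ℝ (Fin m))) := by
        have a1 : MeasurePreserving (fun x : V => Uᗮ.orthogonalProjectionOnto x) γ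
          (stdGaussian Uᗮ) := ⟨by fun_prop, stdGaussian_map_proj _⟩
        have a2 : MeasurePreserving e (stdGaussian Uᗮ)
          (stdGaussian (EuclideanSpace ℝ (Fin m))) := ⟨by fun_prop, stdGaussian_map e⟩
        exact a2.comp a1
      refine ⟨_, hT, ?_⟩
      filter_upwards [hT.quasiMeasurePreserving.ae w1] with x hx
      have hx' : ‖Uᗮ.orthogonalProjectionOnto x‖ ^ 2 ≠ 0 := by
        rw [← e.norm_map]
        exact pow_ne_zero _ (norm_ne_zero_iff.2 hx)
      have hdet := gram_det_snoc v x hv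
      refine ⟨by rw [hdet]; exact mul_ne_zero hv hx', ?_⟩
      simp only [hG]
      rw [hdet, Real.log_mul hv hx', e.norm_map]
      ring
    have hGint : ∀ v, (gram ℝ v).det ≠ 0 → Integrable (fun x => G (v, x)) γ ∧
        ∫ x, ‖G (v, x)‖ ∂γ = ∫ y, ‖Real.log (‖y‖ ^ 2)‖ ∂(stdGaussian (EuclideanSpace ℝ (Fin m))) ∧
        ∫ x, G (v, x) ∂γ = c := by
      intro v hv
      obtain ⟨T, hT, hx⟩ := hfib v hv
      have hx2 : (fun x => G (v, x)) =ᵐ[γ] fun x => Real.log (‖T x‖ ^ 2) := by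
        filter_upwards [hx] with x h using h.2
      refine ⟨(hT.integrable_comp_of_integrable w2).congr hx2.symm, ?_, ?_⟩
      · rw [← hT.map_eq, integral_map hT.measurable.aemeasurable
          (Measurable.aestronglyMeasurable (by fun_prop))]
        refine integral_congr_ae ?_
        filter_upwards [hx2] with x h
        rw [h]
      · rw [← w3, ← hT.map_eq, integral_map hT.measurable.aemeasurable
          (Measurable.aestronglyMeasurable (by fun_prop))]
        exact integral_congr_ae hx2
    have hGI : Integrable G (ν.prod γ) := by
      rw [integrable_prod_iff hGm.aestronglyMeasurable]
      constructor
      · filter_upwards [ih1] with v hv using (hGint v hv).1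
      · refine (integrable_const (∫ y, ‖Real.log (‖y‖ ^ 2)‖
          ∂(stdGaussian (EuclideanSpace ℝ (Fin m))))).congr ?_
        filter_upwards [ih1] with v hv using (hGint v hv).2.1.symm
    have hGc : ∫ p, G p ∂(ν.prod γ) = c := by
      rw [integral_prod _ hGI]
      have : (fun v => ∫ x, G (v, x) ∂γ) =ᵐ[ν] fun _ => c := by
        filter_upwards [ih1] with v hv using (hGint v hv).2.2
      rw [integral_congr_ae this]
      simp
    have hfst : Integrable (fun p : (Fin k → V) × V => Real.log (gram ℝ p.1).det) (ν.prod γ) :=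
      ih2.comp_fst γ
    have hfsti : ∫ p : (Fin k → V) × V, Real.log (gram ℝ p.1).det ∂(ν.prod γ)
        = ∫ v, Real.log (gram ℝ v).det ∂ν := by
      rw [integral_fun_fst (fun v : Fin k → V => Real.log (gram ℝ v).det)]
      simp
    have hsum : (fun p : (Fin k → V) × V =>
        Real.log (gram ℝ (Fin.snoc p.1 p.2 : Fin (k+1) → V)).det) =
        fun p => G p + Real.log (gram ℝ p.1).det := by
      ext p; simp [hG]
    rw [← hmp2.map_eq]
    have hlm : Measurable (fun v : Fin (k+1) → V => Real.log (gram ℝ v).det) :=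
      Real.measurable_log.comp (measurable_gram_det (k+1))
    refine ⟨?_, ?_, ?_⟩
    · have hms : MeasurableSet {v : Fin (k+1) → V | (gram ℝ v).det ≠ 0} :=
        (measurable_gram_det (k+1)) (measurableSet_singleton 0).compl
      refine (ae_map_iff hmp2.measurable.aemeasurable hms).2
        ((Measure.ae_prod_iff_ae_ae (hmp2.measurable hms)).2 ?_)
      filter_upwards [ih1] with v hv
      obtain ⟨T, hT, hx⟩ := hfib v hv
      filter_upwards [hx] with x h using h.1
    · rw [integrable_map_measure hlm.aestronglyMeasurable hmp2.measurable.aemeasurable]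
      change Integrable (fun p : (Fin k → V) × V =>
        Real.log (gram ℝ (Fin.snoc p.1 p.2 : Fin (k+1) → V)).det) _
      rw [hsum]
      exact hGI.add hfst
    · rw [integral_map hmp2.measurable.aemeasurable hlm.aestronglyMeasurable, hsum,
        integral_add hGI hfst, hGc, hfsti, ih3, Finset.sum_range_succ, add_comm]
end gramdet

lemma pi_swap_measurePreserving (n d : ℕ) (μ : Measure ℝ) [IsProbabilityMeasure μ] :
    MeasurePreserving (fun (Y : Fin n → Fin d → ℝ) (j : Fin d) (i : Fin n) => Y i j)
      (Measure.pi fun _ => Measure.pi fun _ => μ) (Measure.pi fun _ => Measure.pi fun _ => μ) := by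
  have h1 : ∀ n d : ℕ, MeasurePreserving (MeasurableEquiv.curry (Fin n) (Fin d) ℝ)
      (Measure.pi fun _ : Fin n × Fin d => μ) (Measure.pi fun _ => Measure.pi fun _ => μ) := by
    intro n d
    refine ⟨by fun_prop, ?_⟩
    have := Measure.infinitePi_map_curry (fun (_ : Fin n) (_ : Fin d) => μ)
    simpa only [Measure.infinitePi_eq_pi] using this
  have h2 := measurePreserving_piCongrLeft (fun _ : Fin d × Fin n => μ)
    (Equiv.prodComm (Fin n) (Fin d))
  have h3 := ((h1 d n).comp h2).comp (h1 n d).symm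
  convert h3 using 1
  ext Y j i
  rfl

lemma sample_measurePreserving (n d : ℕ) :
    MeasurePreserving (fun (Y : Fin n → Fin d → ℝ) (j : Fin d) =>
        (WithLp.toLp 2 (fun i => Y i j) : EuclideanSpace ℝ (Fin n)))
      (stdGaussianSample n d) (Measure.pi fun _ => stdGaussian (EuclideanSpace ℝ (Fin n))) := by
  have h1 : MeasurePreserving (WithLp.toLp 2 : (Fin n → ℝ) → EuclideanSpace ℝ (Fin n))
      (Measure.pi fun _ => gaussianReal 0 1) (stdGaussian (EuclideanSpace ℝ (Fin n))) :=
    ⟨by fun_prop, map_pi_eq_stdGaussian⟩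
  exact (measurePreserving_pi (fun _ : Fin d => Measure.pi fun _ : Fin n => gaussianReal 0 1) _
    (fun _ => h1)).comp (pi_swap_measurePreserving n d (gaussianReal 0 1))

lemma empSecondMoment_eq_gram (n d : ℕ) (Y : Fin n → Fin d → ℝ) :
    empSecondMoment n d Y = (n : ℝ)⁻¹ • gram ℝ (fun j : Fin d =>
        (WithLp.toLp 2 (fun i => Y i j) : EuclideanSpace ℝ (Fin n))) := by
  ext a b
  simp [empSecondMoment, gram_apply, Matrix.sum_apply, vecMulVec_apply, PiLp.inner_apply, mul_comm]

lemma sample_trace (n d : ℕ) (hn : 0 < n) :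
    Integrable (fun Y => (empSecondMoment n d Y).trace) (stdGaussianSample n d) ∧
    ∫ Y, (empSecondMoment n d Y).trace ∂(stdGaussianSample n d) = d := by
  have htr : ∀ Y, (empSecondMoment n d Y).trace = (n : ℝ)⁻¹ * ∑ i, ∑ j, Y i j ^ 2 := by
    intro Y
    simp [empSecondMoment, Matrix.trace_sum, Matrix.trace_vecMulVec, dotProduct, sq]
  have h2 : Integrable (fun x : ℝ => x ^ 2) (gaussianReal 0 1) :=
    (memLp_id_gaussianReal 2).integrable_sq
  have h3 : ∫ x : ℝ, x ^ 2 ∂(gaussianReal 0 1) = 1 := by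
    have := variance_fun_id_gaussianReal (μ := 0) (v := 1)
    rw [variance_of_integral_eq_zero (by fun_prop) (by simp)] at this
    simpa using this
  have hmp : ∀ i j, MeasurePreserving (fun Y : Fin n → Fin d → ℝ => Y i j)
      (stdGaussianSample n d) (gaussianReal 0 1) := fun i j =>
    (measurePreserving_eval (fun _ : Fin d => gaussianReal 0 1) j).comp
      (measurePreserving_eval (fun _ : Fin n => Measure.pi fun _ : Fin d => gaussianReal 0 1) i)
  have hI : ∀ i j, Integrable (fun Y : Fin n → Fin d → ℝ => Y i j ^ 2) (stdGaussianSample n d) :=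
    fun i j => (hmp i j).integrable_comp_of_integrable h2
  have hE : ∀ i j, ∫ Y : Fin n → Fin d → ℝ, Y i j ^ 2 ∂(stdGaussianSample n d) = 1 := by
    intro i j
    rw [← h3, ← (hmp i j).map_eq, integral_map (hmp i j).measurable.aemeasurable (by fun_prop)]
  simp_rw [htr]
  constructor
  · exact (integrable_finsetSum _ fun i _ => integrable_finsetSum _ fun j _ => hI i j).const_mul _
  · rw [integral_const_mul, integral_finsetSum _
      fun i _ => integrable_finsetSum _ fun j _ => hI i j]
    simp_rw [integral_finsetSum _ fun j _ => hI _ j, hE]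
    simp
    field_simp

theorem reverse_KL_known_mean_closed_form (d n : ℕ) (hd : 1 ≤ d) (hn : d ≤ n) :
    ∫ Y, (1 / 2) * ((empSecondMoment n d Y).trace - d
        - Real.log (empSecondMoment n d Y).det) ∂(stdGaussianSample n d)
      = (1 / 2) * (d * Real.log (n / 2)
          - ∑ j ∈ Finset.Icc 1 d, digamma (((n : ℝ) - j + 1) / 2)) := by
  have hn0 : 0 < n := by omega
  have hnR : (0:ℝ) < n := by exact_mod_cast hn0
  have : IsProbabilityMeasure (stdGaussianSample n d) := by
    unfold stdGaussianSample; infer_instance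
  obtain ⟨t1, t2⟩ := sample_trace n d hn0
  obtain ⟨g1, g2, g3⟩ := gram_log_det (V := EuclideanSpace ℝ (Fin n)) d (by simpa using hn)
  have hmp := sample_measurePreserving n d
  set Φ := (fun (Y : Fin n → Fin d → ℝ) (j : Fin d) =>
        (WithLp.toLp 2 (fun i => Y i j) : EuclideanSpace ℝ (Fin n))) with hΦ
  have hlm : Measurable (fun v : Fin d → EuclideanSpace ℝ (Fin n) => Real.log (gram ℝ v).det) :=
    Real.measurable_log.comp (measurable_gram_det d)
  have k1 : Integrable (fun Y => Real.log (gram ℝ (Φ Y)).det) (stdGaussianSample n d) :=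
    hmp.integrable_comp_of_integrable g2
  have k2 : ∫ Y, Real.log (gram ℝ (Φ Y)).det ∂(stdGaussianSample n d) =
      ∑ j ∈ Finset.range d, (Real.log 2 + digamma (((n : ℝ) - j) / 2)) := by
    rw [← hmp.map_eq, integral_map hmp.measurable.aemeasurable hlm.aestronglyMeasurable] at g3
    rw [g3, finrank_euclideanSpace_fin]
  have k3 : (fun Y => (1 / 2) * ((empSecondMoment n d Y).trace - d
        - Real.log (empSecondMoment n d Y).det)) =ᵐ[stdGaussianSample n d]
      fun Y => (1 / 2) * (((empSecondMoment n d Y).trace - d)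
        - (Real.log (gram ℝ (Φ Y)).det - d * Real.log n)) := by
    filter_upwards [hmp.quasiMeasurePreserving.ae g1] with Y hY
    have : Real.log (empSecondMoment n d Y).det
        = Real.log (gram ℝ (Φ Y)).det - d * Real.log n := by
      rw [empSecondMoment_eq_gram, det_smul, Real.log_mul (by positivity) hY, Real.log_pow,
        Real.log_inv, Fintype.card_fin]
      ring
    rw [this]
  rw [integral_congr_ae k3, integral_const_mul, integral_sub
    (show Integrable (fun Y => (empSecondMoment n d Y).trace - (d : ℝ)) (stdGaussianSample n d) from
      t1.sub (integrable_const _))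
    (show Integrable (fun Y => Real.log (gram ℝ (Φ Y)).det - d * Real.log n)
      (stdGaussianSample n d) from k1.sub (integrable_const _)), integral_sub t1 (integrable_const _),
    integral_sub k1 (integrable_const _), t2, k2]
  have hs : ∑ j ∈ Finset.Icc 1 d, digamma (((n : ℝ) - j + 1) / 2)
      = ∑ j ∈ Finset.range d, digamma (((n : ℝ) - j) / 2) := by
    rw [← Finset.Ico_add_one_right_eq_Icc, Finset.sum_Ico_eq_sum_range]
    refine Finset.sum_congr (by simp) fun j _ => ?_
    push_cast
    congr 2
    ring
  rw [hs, Finset.sum_add_distrib, Real.log_div hnR.ne' (by norm_num)]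
  simp
  ring
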